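/- Proposition 2.5: Let k ≥ 2 be an integer, ε > 0, and let f ≥ 1 be an integer. Let m be an integer satisfying (m−1)/((2k+1)m) ≥ 1/(2k+1) − ε and m > (2k+1)(k−1)f + 3f. Let G be the graph with vertex set {v^{(α)}_x : α ∈ {1,…,2k+1}, x ∈ {1,…,m}^{k−1}} (so |V(G)| = (2k+1)·m^{k−1}) and edges defined by: (i) for each α ∈ {1,…,k−1}, v^{(2α−1)}_x is adjacent to v^{(2α)}_y if and only if x_1 ≠ y_1; (ii) for each p ∈ {1,…,k−2}, each α ∈ {1,…,2p} and each β ∈ {2p+1, 2p+2}, v^{(α)}_x is adjacent to v^{(β)}_y if and only if p is the largest integer such that x_i = y_i for all i ∈ {1,…,p}; (iii) for each α ∈ {1,…,2k−2} and each β ∈ {2k−1, 2k, 2k+1}, v^{(α)}_x is adjacent to v^{(β)}_y if and only if x_i = y_i for all i ∈ {1,…,k−1}; (iv) for (α,β) ∈ {(2k−1,2k), (2k,2k+1), (2k+1,2k−1)}, v^{(α)}_x is adjacent to v^{(β)}_y if and only if x_1 < y_1; there are no other edges. Then: (1) the minimum degree of G is at least (m−1)·m^{k−2} = ((m−1)/((2k+1)m))·|V(G)|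 ≥ (1/(2k+1) − ε)·|V(G)|; (2) G is triangle-free; (3) the VC-dimension of G is at most 4k²; (4) if there is a graph homomorphism from G to a graph H with at most f vertices, then H contains a clique on 2k+1 vertices. -/

import Mathlib

open SimpleGraph

/-- A set `S` of vertices of a graph `G` is shattered if every subset of `S` is
a trace of a vertex neighborhood on `S`. -/
def Shattered {V : Type*} (G : SimpleGraph V) (S : Set V) : Prop :=
  ∀ S' ⊆ S, ∃ v : V, G.neighborSet v ∩ S = S'

/-- The (directed) edge rules of Definition 2.4. A vertex is a pair `(α, x)` with
`α ∈ [2k+1]` (encoded as `Fin (2k+1)`, so the paper's index is `u.1.val + 1`) and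
`x ∈ [m]^{k−1}`.
Rule (i): for odd `α ≤ 2(k−1)−1`, `(α, x) ~ (α+1, y)` iff `x₁ ≠ y₁`.
Rule (ii): for `p ∈ [k−2]`, `α ∈ [2p]`, `β ∈ {2p+1, 2p+2}`, `(α, x) ~ (β, y)` iff
`p` is the maximal integer with `xᵢ = yᵢ` for all `i ∈ [p]`.
Rule (iii): for `α ∈ [2k−2]`, `β ∈ {2k−1, 2k, 2k+1}`, `(α, x) ~ (β, y)` iff `x = y`.
Rule (iv): for `(α, β) ∈ {(2k−1,2k), (2k,2k+1), (2k+1,2k−1)}`, `(α, x) ~ (β, y)`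
iff `x₁ < y₁`. -/
def rel2k1 (k m : ℕ) (u w : Fin (2 * k + 1) × (Fin (k - 1) → Fin m)) : Prop :=
  ((u.1.val + 1) % 2 = 1 ∧ u.1.val + 1 ≤ 2 * (k - 1) - 1 ∧ w.1.val = u.1.val + 1 ∧
    ∃ i : Fin (k - 1), (i : ℕ) = 0 ∧ u.2 i ≠ w.2 i) ∨
  (∃ p : ℕ, 1 ≤ p ∧ p ≤ k - 2 ∧ u.1.val + 1 ≤ 2 * p ∧
    (w.1.val + 1 = 2 * p + 1 ∨ w.1.val + 1 = 2 * p + 2) ∧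
    (∀ i : Fin (k - 1), (i : ℕ) + 1 ≤ p → u.2 i = w.2 i) ∧
    (∀ i : Fin (k - 1), (i : ℕ) + 1 = p + 1 → u.2 i ≠ w.2 i)) ∨
  (u.1.val + 1 ≤ 2 * k - 2 ∧ 2 * k - 1 ≤ w.1.val + 1 ∧
    ∀ i : Fin (k - 1), u.2 i = w.2 i) ∨
  (((u.1.val + 1 = 2 * k - 1 ∧ w.1.val + 1 = 2 * k) ∨
      (u.1.val + 1 = 2 * k ∧ w.1.val + 1 = 2 * k + 1) ∨
      (u.1.val + 1 = 2 * k + 1 ∧ w.1.val + 1 = 2 * k - 1)) ∧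
    ∃ i : Fin (k - 1), (i : ℕ) = 0 ∧ u.2 i < w.2 i)

/-- The `(2k+1)`-partite triangle-free graph of Definition 2.4 on `(2k+1)·m^{k−1}`
vertices. -/
def G2k1 (k m : ℕ) : SimpleGraph (Fin (2 * k + 1) × (Fin (k - 1) → Fin m)) :=
  SimpleGraph.fromRel (rel2k1 k m)

/-- `x` and `y` agree in all coordinates before `q` and differ in coordinate `q`. -/
def DivergesAt {n m : ℕ} (q : ℕ) (x y : Fin n → Fin m) : Prop :=
  (∀ i : Fin n, (i : ℕ) < q → x i = y i) ∧ ∃ i : Fin n, (i : ℕ) = q ∧ x i ≠ y i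

theorem DivergesAt.symm {n m q : ℕ} {x y : Fin n → Fin m} (h : DivergesAt q x y) :
    DivergesAt q y x :=
  ⟨fun i hi => (h.1 i hi).symm, h.2.imp fun _ hi => ⟨hi.1, hi.2.symm⟩⟩

theorem DivergesAt.ne {n m q : ℕ} {x y : Fin n → Fin m} (h : DivergesAt q x y) : x ≠ y := by
  rintro rfl
  obtain ⟨_, _, h⟩ := h.2
  exact h rfl

theorem DivergesAt.not_lt_lt {n m p q r : ℕ} {x y z : Fin n → Fin m} (hxy : DivergesAt p x y)
    (hyz : DivergesAt q y z) (hxz : DivergesAt r x z) (hq : p < q) : ¬ p < r := by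
  intro hr
  obtain ⟨i, rfl, hi⟩ := hxy.2
  exact hi ((hxz.1 i hr).trans (hyz.1 i hq).symm)

/-- The coordinate at which adjacent vertices of the distinct classes `α, β < 2k - 2` diverge. -/
def divergenceLevel (α β : ℕ) : ℕ := if α / 2 = β / 2 then 0 else max (α / 2) (β / 2)

theorem divergenceLevel_comm (α β : ℕ) : divergenceLevel α β = divergenceLevel β α := by
  unfold divergenceLevel
  split_ifs <;> omega

section Adjacency

variable {k m : ℕ} {α β : Fin (2 * k + 1)} {x y : Fin (k - 1) → Fin m}

theorem not_adj_same_class : ¬ (G2k1 k m).Adj (α, x) (α, y) := by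
  have := α.2
  simp only [G2k1, SimpleGraph.fromRel_adj, rel2k1]
  rintro ⟨-, (h | ⟨p, h⟩ | h | ⟨h, -⟩) | (h | ⟨p, h⟩ | h | ⟨h, -⟩)⟩ <;> omega

theorem adj_low_of_lt (hβ : (β : ℕ) < 2 * k - 2) (h : α < β) :
    (G2k1 k m).Adj (α, x) (β, y) ↔ DivergesAt (divergenceLevel α β) x y := by
  have hab : (α : ℕ) < β := h
  have hne : (α, x) ≠ (β, y) := fun e => h.ne (congrArg Prod.fst e)
  simp only [G2k1, SimpleGraph.fromRel_adj, rel2k1, DivergesAt, divergenceLevel]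
  constructor
  · rintro ⟨-, (h | ⟨p, h⟩ | h | ⟨h, -⟩) | (h | ⟨p, h⟩ | h | ⟨h, -⟩)⟩ <;> try omega
    · rw [if_pos (by omega)]
      exact ⟨fun i hi => by omega, h.2.2.2⟩
    · obtain ⟨h1, h2, h3, h4, h5, h6⟩ := h
      have hp : max ((α : ℕ) / 2) ((β : ℕ) / 2) = p := by omega
      rw [if_neg (by omega), hp]
      exact ⟨fun i hi => h5 i hi, ⟨p, by omega⟩, rfl, h6 _ rfl⟩
  · rintro ⟨h1, i, hi, hne'⟩
    refine ⟨hne, Or.inl ?_⟩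
    split_ifs at h1 hi with hb
    · exact Or.inl ⟨by omega, by omega, by omega, i, hi, hne'⟩
    · refine Or.inr (Or.inl ⟨(β : ℕ) / 2, by omega, by omega, by omega, by omega,
        fun j hj => h1 j (by omega), fun j hj => ?_⟩)
      rwa [show j = i from Fin.ext (by omega)]

theorem adj_low (hα : (α : ℕ) < 2 * k - 2) (hβ : (β : ℕ) < 2 * k - 2) (h : α ≠ β) :
    (G2k1 k m).Adj (α, x) (β, y) ↔ DivergesAt (divergenceLevel α β) x y := by
  rcases lt_or_gt_of_ne h with h | h
  · exact adj_low_of_lt hβ h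
  · rw [SimpleGraph.adj_comm, adj_low_of_lt hα h, divergenceLevel_comm]
    exact ⟨DivergesAt.symm, DivergesAt.symm⟩

theorem adj_low_high (hα : (α : ℕ) < 2 * k - 2) (hβ : 2 * k - 2 ≤ (β : ℕ)) :
    (G2k1 k m).Adj (α, x) (β, y) ↔ x = y := by
  have hne : (α, x) ≠ (β, y) := fun e => by
    have := congrArg (fun v => (v.1 : ℕ)) e
    simp only at this
    omega
  simp only [G2k1, SimpleGraph.fromRel_adj, rel2k1]
  constructor
  · rintro ⟨-, (h | ⟨p, h⟩ | h | ⟨h, -⟩) | (h | ⟨p, h⟩ | h | ⟨h, -⟩)⟩ <;> try omega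
    exact funext h.2.2
  · rintro rfl
    exact ⟨hne, Or.inl (Or.inr (Or.inr (Or.inl ⟨by omega, by omega, fun _ => rfl⟩)))⟩

theorem adj_high_succ (hk : 2 ≤ k) (h : 2 * k - 2 ≤ (α : ℕ) ∧ (β : ℕ) = α + 1 ∨
      (α : ℕ) = 2 * k ∧ (β : ℕ) = 2 * k - 2) :
    (G2k1 k m).Adj (α, x) (β, y) ↔ x ⟨0, by omega⟩ < y ⟨0, by omega⟩ := by
  have hne : (α, x) ≠ (β, y) := fun e => by
    have := congrArg (fun v => (v.1 : ℕ)) e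
    simp only at this
    omega
  have := β.2
  simp only [G2k1, SimpleGraph.fromRel_adj, rel2k1]
  constructor
  · rintro ⟨-, (h | ⟨p, h⟩ | h | ⟨h, i, hi, hlt⟩) | (h | ⟨p, h⟩ | h | ⟨h, i, hi, hlt⟩)⟩ <;>
      try omega
    rwa [show i = ⟨0, by omega⟩ from Fin.ext hi] at hlt
  · intro hlt
    exact ⟨hne, Or.inl (Or.inr (Or.inr (Or.inr ⟨by omega, _, rfl, hlt⟩)))⟩

/-- Distinct classes among the last three are consecutive in their cyclic order. -/
theorem high_cyclic (hα : 2 * k - 2 ≤ (α : ℕ)) (hβ : 2 * k - 2 ≤ (β : ℕ)) (h : α ≠ β) :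
    (2 * k - 2 ≤ (α : ℕ) ∧ (β : ℕ) = α + 1 ∨ (α : ℕ) = 2 * k ∧ (β : ℕ) = 2 * k - 2) ∨
    (2 * k - 2 ≤ (β : ℕ) ∧ (α : ℕ) = β + 1 ∨ (β : ℕ) = 2 * k ∧ (α : ℕ) = 2 * k - 2) := by
  have := α.2
  have := β.2
  have : (α : ℕ) ≠ β := fun e => h (Fin.ext e)
  omega

theorem ne_zero_of_adj_high (hk : 2 ≤ k) (hα : 2 * k - 2 ≤ (α : ℕ)) (hβ : 2 * k - 2 ≤ (β : ℕ))
    (h : (G2k1 k m).Adj (α, x) (β, y)) : x ≠ y := by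
  rintro rfl
  have hne : α ≠ β := by
    rintro rfl
    exact not_adj_same_class h
  rcases high_cyclic hα hβ hne with hc | hc
  · exact lt_irrefl _ ((adj_high_succ hk hc).1 h)
  · exact lt_irrefl _ ((adj_high_succ hk hc).1 h.symm)

end Adjacency

theorem cliqueFree_three_G2k1 {k : ℕ} (hk : 2 ≤ k) (m : ℕ) : (G2k1 k m).CliqueFree 3 := by
  intro s hs
  obtain ⟨⟨α, x⟩, ⟨β, y⟩, ⟨γ, z⟩, hab, hac, hbc, -⟩ := SimpleGraph.is3Clique_iff.1 hs
  have nab : α ≠ β := by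
    rintro rfl
    exact not_adj_same_class hab
  have nac : α ≠ γ := by
    rintro rfl
    exact not_adj_same_class hac
  have nbc : β ≠ γ := by
    rintro rfl
    exact not_adj_same_class hbc
  rcases lt_or_ge (α : ℕ) (2 * k - 2) with ha | ha <;>
    rcases lt_or_ge (β : ℕ) (2 * k - 2) with hb | hb <;>
    rcases lt_or_ge (γ : ℕ) (2 * k - 2) with hc | hc
  · rw [adj_low ha hb nab] at hab
    rw [adj_low ha hc nac] at hac
    rw [adj_low hb hc nbc] at hbc
    have key : (divergenceLevel α β < divergenceLevel β γ ∧
          divergenceLevel α β < divergenceLevel α γ) ∨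
        (divergenceLevel α γ < divergenceLevel β γ ∧
          divergenceLevel α γ < divergenceLevel α β) ∨
        (divergenceLevel β γ < divergenceLevel α γ ∧
          divergenceLevel β γ < divergenceLevel α β) := by
      rw [Ne, Fin.ext_iff] at nab nac nbc
      simp only [divergenceLevel]
      split_ifs <;> omega
    rcases key with ⟨h1, h2⟩ | ⟨h1, h2⟩ | ⟨h1, h2⟩
    · exact hab.not_lt_lt hbc hac h1 h2
    · exact hac.not_lt_lt hbc.symm hab h1 h2
    · exact hbc.not_lt_lt hac.symm hab.symm h1 h2
  · exact ((adj_low ha hb nab).1 hab).ne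
      (((adj_low_high ha hc).1 hac).trans ((adj_low_high hb hc).1 hbc).symm)
  · exact ((adj_low ha hc nac).1 hac).ne
      (((adj_low_high ha hb).1 hab).trans ((adj_low_high hc hb).1 hbc.symm).symm)
  · exact ne_zero_of_adj_high hk hb hc hbc
      (((adj_low_high ha hb).1 hab).symm.trans ((adj_low_high ha hc).1 hac))
  · exact ((adj_low hb hc nbc).1 hbc).ne
      (((adj_low_high hb ha).1 hab.symm).trans ((adj_low_high hc ha).1 hac.symm).symm)
  · exact ne_zero_of_adj_high hk ha hc hac
      (((adj_low_high hb ha).1 hab.symm).symm.trans ((adj_low_high hb hc).1 hbc))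
  · exact ne_zero_of_adj_high hk ha hb hab
      (((adj_low_high hc ha).1 hac.symm).symm.trans ((adj_low_high hc hb).1 hbc.symm))
  · rcases high_cyclic ha hb nab with h1 | h1 <;> rcases high_cyclic ha hc nac with h2 | h2 <;>
      rcases high_cyclic hb hc nbc with h3 | h3 <;> try omega
    · exact lt_asymm (((adj_high_succ hk h1).1 hab).trans ((adj_high_succ hk h3).1 hbc))
        ((adj_high_succ hk h2).1 hac.symm)
    · exact lt_asymm (((adj_high_succ hk h3).1 hbc.symm).trans ((adj_high_succ hk h1).1 hab.symm))
        ((adj_high_succ hk h2).1 hac)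

theorem ncard_coord_ne {n m : ℕ} (i : Fin n) (a : Fin m) :
    {y : Fin n → Fin m | y i ≠ a}.ncard = (m - 1) * m ^ (n - 1) := by
  classical
  have h : {y : Fin n → Fin m | y i ≠ a} = (Fintype.piFinset fun j : Fin n =>
      if j = i then Finset.univ.erase a else Finset.univ : Finset (Fin n → Fin m)) := by
    ext y
    simp only [Set.mem_ofPred_eq, Finset.mem_coe, Fintype.mem_piFinset]
    refine ⟨fun h j => ?_, fun h => by simpa using h i⟩
    by_cases hj : j = i
    · subst hj
      simpa using h
    · simp [hj]
  rw [h, Set.ncard_coe_finset, Fintype.card_piFinset,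
    ← Finset.mul_prod_erase _ _ (Finset.mem_univ i),
    Finset.prod_congr rfl (g := fun _ => m) fun j hj => by simp [Finset.ne_of_mem_erase hj]]
  simp

theorem exists_adj_of_ne {k m : ℕ} (hk : 2 ≤ k) (v : Fin (2 * k + 1) × (Fin (k - 1) → Fin m))
    (y : Fin (k - 1) → Fin m) (h : y ⟨0, by omega⟩ ≠ v.2 ⟨0, by omega⟩) :
    ∃ β, (G2k1 k m).Adj v (β, y) := by
  obtain ⟨α, x⟩ := v
  have hlt := α.2
  rcases lt_or_ge (α : ℕ) (2 * k - 2) with ha | ha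
  · have hβ : ∃ β : Fin (2 * k + 1), (β : ℕ) < 2 * k - 2 ∧ α ≠ β ∧ (α : ℕ) / 2 = (β : ℕ) / 2 := by
      rcases Nat.even_or_odd' (α : ℕ) with ⟨c, hc | hc⟩
      · exact ⟨⟨α + 1, by omega⟩, by simp only; omega, by simp [Fin.ext_iff],
          by simp only; omega⟩
      · exact ⟨⟨α - 1, by omega⟩, by simp only; omega, by rw [Ne, Fin.ext_iff]; simp only; omega,
          by simp only; omega⟩
    obtain ⟨β, hb, hne, hdiv⟩ := hβ
    refine ⟨β, (adj_low ha hb hne).2 ?_⟩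
    rw [divergenceLevel, if_pos hdiv]
    exact ⟨fun i hi => absurd hi (Nat.not_lt_zero _), _, rfl, h.symm⟩
  · rcases lt_or_gt_of_ne h with h | h
    · have hβ : ∃ β : Fin (2 * k + 1), 2 * k - 2 ≤ (β : ℕ) ∧ (α : ℕ) = β + 1 ∨
          (β : ℕ) = 2 * k ∧ (α : ℕ) = 2 * k - 2 := by
        by_cases e : (α : ℕ) = 2 * k - 2
        · exact ⟨⟨2 * k, by omega⟩, Or.inr ⟨rfl, e⟩⟩
        · exact ⟨⟨α - 1, by omega⟩, Or.inl (by simp only; omega)⟩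
      obtain ⟨β, hb⟩ := hβ
      exact ⟨β, ((adj_high_succ hk hb).2 h).symm⟩
    · have hβ : ∃ β : Fin (2 * k + 1), 2 * k - 2 ≤ (α : ℕ) ∧ (β : ℕ) = α + 1 ∨
          (α : ℕ) = 2 * k ∧ (β : ℕ) = 2 * k - 2 := by
        by_cases e : (α : ℕ) = 2 * k
        · exact ⟨⟨2 * k - 2, by omega⟩, Or.inr ⟨e, rfl⟩⟩
        · exact ⟨⟨α + 1, by omega⟩, Or.inl ⟨ha, rfl⟩⟩
      obtain ⟨β, hb⟩ := hβ
      exact ⟨β, (adj_high_succ hk hb).2 h⟩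

theorem le_ncard_neighborSet {k m : ℕ} (hk : 2 ≤ k)
    (v : Fin (2 * k + 1) × (Fin (k - 1) → Fin m)) :
    (m - 1) * m ^ (k - 2) ≤ ((G2k1 k m).neighborSet v).ncard := by
  rw [show k - 2 = k - 1 - 1 by omega,
    ← ncard_coord_ne (⟨0, by omega⟩ : Fin (k - 1)) (v.2 ⟨0, by omega⟩)]
  have hsub : {y : Fin (k - 1) → Fin m | y ⟨0, by omega⟩ ≠ v.2 ⟨0, by omega⟩} ⊆
      Set.image Prod.snd ((G2k1 k m).neighborSet v) := fun y hy => by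
    obtain ⟨β, hβ⟩ := exists_adj_of_ne hk v y hy
    exact ⟨(β, y), hβ, rfl⟩
  exact (Set.ncard_le_ncard hsub (Set.toFinite _)).trans (Set.ncard_image_le (Set.toFinite _))

/-- Differences of consecutive prefix clusters, together with singletons, do not shatter
four vectors. -/
theorem not_shattered_by_divergence {n m : ℕ} {S : Finset (Fin n → Fin m)} (hS : 3 < S.card) :
    ¬ ∀ T ⊆ S, ∃ x : Fin n → Fin m,
      (∃ q, ∀ y ∈ S, DivergesAt q x y ↔ y ∈ T) ∨ ∀ y ∈ T, x = y := by
  classical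
  intro h
  let P : ℕ → Prop := fun p =>
    ∃ a ∈ S, ∃ b ∈ S, a ≠ b ∧ ∀ i : Fin n, (i : ℕ) < p → a i = b i
  have hex : ∃ p, ¬ P p :=
    ⟨n, fun ⟨a, _, b, _, hne, hab⟩ => hne (funext fun i => hab i i.2)⟩
  have hmax := Nat.find_spec hex
  have hmin := fun p => Nat.find_min hex (m := p)
  obtain hp | ⟨p, hp⟩ : Nat.find hex = 0 ∨ ∃ p, Nat.find hex = p + 1 := by
    cases Nat.find hex <;> simp
  · obtain ⟨a, ha, b, hb, hne⟩ := Finset.one_lt_card.1 (show 1 < S.card by omega)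
    rw [hp] at hmax
    exact hmax ⟨a, ha, b, hb, hne, fun i hi => absurd hi (Nat.not_lt_zero _)⟩
  rw [hp] at hmax
  obtain ⟨a, ha, b, hb, hab, hagree⟩ := not_not.1 (hmin p (by omega))
  have hinj : ∀ u ∈ S, ∀ w ∈ S, (∀ i : Fin n, (i : ℕ) < p + 1 → u i = w i) → u = w :=
    fun u hu w hw huw => by_contra fun hne => hmax ⟨u, hu, w, hw, hne, huw⟩
  have hcard : 1 < ((S.erase a).erase b).card := by
    rw [Finset.card_erase_of_mem (Finset.mem_erase.2 ⟨hab.symm, hb⟩), Finset.card_erase_of_mem ha]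
    omega
  obtain ⟨c, hc, d, hd, hcd⟩ := Finset.one_lt_card.1 hcard
  simp only [Finset.mem_erase] at hc hd
  have key : ∀ c ∈ S, c ≠ a → c ≠ b → ∀ d ∈ S, d ≠ a → d ≠ b → c ≠ d →
      (∀ i : Fin n, (i : ℕ) < p → a i = c i) ∧ ¬ ∀ i : Fin n, (i : ℕ) < p → a i = d i := by
    intro c hc hca hcb d hd hda hdb hcd
    obtain ⟨x, ⟨q, hq⟩ | hx⟩ := h {a, c} (by
      intro y hy
      rcases Finset.mem_insert.1 hy with rfl | hy
      · exact ha
      · rwa [Finset.mem_singleton.1 hy])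
    · have hxa := (hq a ha).2 (by simp)
      have hxc := (hq c hc).2 (by simp)
      have hxb : ¬ DivergesAt q x b := fun hh => by
        simpa [hab.symm, hcb.symm] using (hq b hb).1 hh
      have hxd : ¬ DivergesAt q x d := fun hh => by
        simpa [hda, hcd.symm] using (hq d hd).1 hh
      have hqp : q ≤ p := by
        by_contra hlt
        exact hca (hinj c hc a ha fun i hi =>
          (hxc.1 i (by omega)).symm.trans (hxa.1 i (by omega)))
      obtain ⟨j, hj, hja⟩ := hxa.2
      have hxb' : x j = b j := by
        by_contra hne
        exact hxb ⟨fun i hi => (hxa.1 i hi).trans (hagree i (by omega)), j, hj, hne⟩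
      have hpq : q = p := by
        by_contra hne
        exact hja (hxb'.trans (hagree j (by omega)).symm)
      subst hpq
      refine ⟨fun i hi => (hxa.1 i hi).symm.trans (hxc.1 i hi), fun had => hxd ?_⟩
      refine ⟨fun i hi => (hxa.1 i hi).trans (had i hi), j, hj, fun hxd' => hdb ?_⟩
      refine hinj d hd b hb fun i hi => ?_
      rcases Nat.lt_succ_iff_lt_or_eq.1 hi with hi | hi
      · exact (had i hi).symm.trans (hagree i hi)
      · rw [show i = j from Fin.ext (hi.trans hj.symm), ← hxd', hxb']
    · exact absurd ((hx a (by simp)).symm.trans (hx c (by simp))) hca.symm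
  exact (key d hd.2.2 hd.2.1 hd.1 c hc.2.2 hc.2.1 hc.1 hcd.symm).2
    (key c hc.2.2 hc.2.1 hc.1 d hd.2.2 hd.2.1 hd.1 hcd).1

/-- Rays with respect to a preorder induced by `g`, together with singletons, do not shatter
three elements. -/
theorem not_shattered_by_rays {X Y : Type*} [LinearOrder Y] (g : X → Y) {S : Finset X}
    (hS : 2 < S.card) :
    ¬ ∀ T ⊆ S, ∃ x : X, (∀ y ∈ S, g x < g y ↔ y ∈ T) ∨ (∀ y ∈ S, g y < g x ↔ y ∈ T) ∨
      ∀ y ∈ T, x = y := by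
  classical
  intro h
  obtain ⟨a, ha, hmin⟩ := S.exists_min_image g (Finset.card_pos.1 (by omega))
  have h1 := Finset.card_erase_of_mem ha
  obtain ⟨c, hc, hmax⟩ := (S.erase a).exists_max_image g (Finset.card_pos.1 (by omega))
  have h2 := Finset.card_erase_of_mem hc
  obtain ⟨b, hb⟩ := Finset.card_pos.1 (show 0 < ((S.erase a).erase c).card by omega)
  simp only [Finset.mem_erase] at hb hc hmax
  have hab := hmin b hb.2.2
  have hbc := hmax b hb.2
  have hbT : b ∉ ({a, c} : Finset X) := by simp [hb.1, hb.2.1]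
  obtain ⟨x, hx | hx | hx⟩ := h {a, c} (by
    intro y hy
    rcases Finset.mem_insert.1 hy with rfl | hy
    · exact ha
    · rw [Finset.mem_singleton.1 hy]
      exact hc.2)
  · exact hbT ((hx b hb.2.2).1 (((hx a ha).2 (by simp)).trans_le hab))
  · exact hbT ((hx b hb.2.2).1 (hbc.trans_lt ((hx c hc.2).2 (by simp))))
  · exact hc.1 ((hx c (by simp)).symm.trans (hx a (by simp)))

theorem not_shattered_of_class {k m : ℕ} (hk : 2 ≤ k) (α : Fin (2 * k + 1))
    {S : Finset (Fin (k - 1) → Fin m)} (hS : 3 < S.card) :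
    ¬ ∀ T ⊆ S, ∃ v, ∀ y ∈ S, (G2k1 k m).Adj v (α, y) ↔ y ∈ T := by
  intro h
  rcases lt_or_ge (α : ℕ) (2 * k - 2) with ha | ha
  · refine not_shattered_by_divergence hS fun T hT => ?_
    obtain ⟨⟨β, x⟩, hv⟩ := h T hT
    refine ⟨x, ?_⟩
    rcases lt_or_ge (β : ℕ) (2 * k - 2) with hb | hb
    · by_cases hne : β = α
      · subst hne
        exact Or.inr fun y hy => absurd ((hv y (hT hy)).2 hy) not_adj_same_class
      · exact Or.inl ⟨divergenceLevel β α, fun y hy => (adj_low hb ha hne).symm.trans (hv y hy)⟩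
    · exact Or.inr fun y hy => ((adj_low_high ha hb).1 ((hv y (hT hy)).2 hy).symm).symm
  · refine not_shattered_by_rays (fun x : Fin (k - 1) → Fin m => x ⟨0, by omega⟩)
      (Nat.lt_of_succ_lt hS) fun T hT => ?_
    obtain ⟨⟨β, x⟩, hv⟩ := h T hT
    refine ⟨x, ?_⟩
    rcases lt_or_ge (β : ℕ) (2 * k - 2) with hb | hb
    · exact Or.inr (Or.inr fun y hy => (adj_low_high hb ha).1 ((hv y (hT hy)).2 hy))
    · by_cases hne : β = α
      · subst hne
        exact Or.inr (Or.inr fun y hy => absurd ((hv y (hT hy)).2 hy) not_adj_same_class)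
      · rcases high_cyclic hb ha hne with hc | hc
        · exact Or.inl fun y hy => (adj_high_succ hk hc).symm.trans (hv y hy)
        · exact Or.inr (Or.inl fun y hy =>
            (adj_high_succ hk hc).symm.trans ((SimpleGraph.adj_comm _ _ _).trans (hv y hy)))

theorem ncard_le_of_shattered_G2k1 {k m : ℕ} (hk : 2 ≤ k)
    (S : Set (Fin (2 * k + 1) × (Fin (k - 1) → Fin m))) (hS : Shattered (G2k1 k m) S) :
    S.ncard ≤ 4 * k ^ 2 := by
  classical
  by_contra! hlt
  rw [Set.ncard_eq_toFinset_card'] at hlt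
  obtain ⟨α, -, hα⟩ := Finset.exists_lt_card_fiber_of_mul_lt_card_of_maps_to
    (s := S.toFinset) (t := Finset.univ) (f := Prod.fst) (n := 3) (fun _ _ => Finset.mem_univ _)
    (by rw [Finset.card_univ, Fintype.card_fin]; nlinarith)
  refine not_shattered_of_class (m := m) hk α
    (S := Finset.univ.filter fun y => (α, y) ∈ S) (hα.trans_le ?_) fun T hT => ?_
  · refine Finset.card_le_card_of_injOn Prod.snd ?_ ?_
    · rintro ⟨β, y⟩ hy
      simp only [Finset.coe_filter, Set.mem_toFinset, Set.mem_ofPred_eq] at hy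
      simpa [← hy.2] using hy.1
    · rintro ⟨β, y⟩ hy ⟨γ, w⟩ hw hyw
      simp only [Finset.coe_filter, Set.mem_toFinset, Set.mem_ofPred_eq] at hy hw hyw
      rw [hy.2, hw.2, hyw]
  · obtain ⟨v, hv⟩ := hS (Set.image (fun y => (α, y)) (T : Set _)) (by
      rintro _ ⟨y, hy, rfl⟩
      simpa using hT hy)
    refine ⟨v, fun y hy => ?_⟩
    have hyS : (α, y) ∈ S := by simpa using hy
    have := Set.ext_iff.1 hv (α, y)
    simpa [hyS] using this

/-- If every `B i` meets each line in direction `p i` in at most one point per color of `g i`,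
then some vector avoids all the sets `B i`. -/
theorem exists_forall_notMem_of_lines {ι W : Type*} [Fintype ι] [Fintype W] {n m : ℕ}
    (B : ι → Finset (Fin n → Fin m)) (g : ι → (Fin n → Fin m) → W) (p : ι → Fin n) (hn : 0 < n)
    (hB : ∀ i, ∀ x ∈ B i, ∀ y ∈ B i, g i x = g i y → (∀ j, j ≠ p i → x j = y j) → x = y)
    (hcard : Fintype.card ι * Fintype.card W < m) : ∃ x, ∀ i, x ∉ B i := by
  classical
  have hle : ∀ i, (B i).card ≤ Fintype.card W * m ^ (n - 1) := fun i => by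
    have hinj : (B i).card ≤
        (Finset.univ : Finset (W × ({j : Fin n // j ≠ p i} → Fin m))).card := by
      refine Finset.card_le_card_of_injOn (fun x => (g i x, fun j => x j))
        (fun _ _ => Finset.mem_coe.2 (Finset.mem_univ _)) fun x hx y hy hxy => ?_
      rw [Prod.mk.injEq] at hxy
      exact hB i x hx y hy hxy.1 fun j hj => congrFun hxy.2 ⟨j, hj⟩
    simpa [Fintype.card_subtype_compl] using hinj
  have hlt : (Finset.univ.biUnion B).card < (Finset.univ : Finset (Fin n → Fin m)).card := by
    calc (Finset.univ.biUnion B).card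
        ≤ Fintype.card ι * (Fintype.card W * m ^ (n - 1)) :=
          Finset.card_biUnion_le_card_mul _ _ _ fun i _ => hle i
      _ = (Fintype.card ι * Fintype.card W) * m ^ (n - 1) := (mul_assoc _ _ _).symm
      _ < m * m ^ (n - 1) := Nat.mul_lt_mul_of_pos_right hcard (pow_pos (by omega) _)
      _ = _ := by
        rw [← pow_succ', Nat.sub_add_cancel hn]
        simp
  obtain ⟨x, -, hx⟩ := Finset.exists_mem_notMem_of_card_lt_card hlt
  exact ⟨x, fun i hi => hx (Finset.mem_biUnion.2 ⟨i, Finset.mem_univ i, hi⟩)⟩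

theorem exists_rich_vector {k m : ℕ} (hk : 2 ≤ k) {W : Type*} [Fintype W]
    (φ : Fin (2 * k + 1) → (Fin (k - 1) → Fin m) → W)
    (hm : (2 * k + 1) * (k - 1) * Fintype.card W + 3 * Fintype.card W < m) :
    ∃ x, (∀ α (p : Fin (k - 1)), ∃ x', φ α x' = φ α x ∧ DivergesAt p x x') ∧
      ∀ α : Fin (2 * k + 1), 2 * k - 2 ≤ (α : ℕ) →
        ∃ y, φ α y = φ α x ∧ x ⟨0, by omega⟩ < y ⟨0, by omega⟩ := by
  classical
  let z : Fin (k - 1) := ⟨0, by omega⟩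
  let top : Fin 3 → Fin (2 * k + 1) := fun j => ⟨2 * k - 2 + j, by omega⟩
  obtain ⟨x, hx⟩ := exists_forall_notMem_of_lines (ι := (Fin (2 * k + 1) × Fin (k - 1)) ⊕ Fin 3)
    (Sum.elim
      (fun i => Finset.univ.filter fun x => ¬ ∃ x', φ i.1 x' = φ i.1 x ∧ DivergesAt i.2 x x')
      (fun j => Finset.univ.filter fun x => ¬ ∃ y, φ (top j) y = φ (top j) x ∧ x z < y z))
    (Sum.elim (fun i => φ i.1) (fun j => φ (top j))) (Sum.elim (fun i => i.2) fun _ => z)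
    (by omega) (by
      rintro (⟨α, p⟩ | j) x hx y hy hxy hline
      · simp only [Sum.elim_inl, Finset.mem_filter_univ, not_exists, not_and] at hx hxy hline
        by_contra hne
        refine hx y hxy.symm ⟨fun i hi => hline i fun e => ?_, p, rfl, fun hp => hne ?_⟩
        · simp [e] at hi
        · funext i
          by_cases hi : i = p
          · rw [hi, hp]
          · exact hline i hi
      · simp only [Sum.elim_inr, Finset.mem_filter_univ, not_exists, not_and, not_lt]
          at hx hy hxy hline
        funext i
        by_cases hi : i = z
        · rw [hi]
          exact le_antisymm (hy x hxy) (hx y hxy.symm)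
        · exact hline i hi)
    (by simpa [add_mul] using hm)
  refine ⟨x, fun α p => by simpa using hx (Sum.inl (α, p)), fun α hα => ?_⟩
  have := hx (Sum.inr ⟨α - (2 * k - 2), by omega⟩)
  have htop : top ⟨α - (2 * k - 2), by omega⟩ = α := Fin.ext (by simp only [top]; omega)
  simp only [Sum.elim_inr, Finset.mem_filter_univ, not_not, htop] at this
  exact this

theorem not_cliqueFree_of_hom_G2k1 {k m : ℕ} (hk : 2 ≤ k) {W : Type*} [Finite W]
    {H : SimpleGraph W} (hm : (2 * k + 1) * (k - 1) * Nat.card W + 3 * Nat.card W < m)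
    (φ : G2k1 k m →g H) : ¬ H.CliqueFree (2 * k + 1) := by
  have := Fintype.ofFinite W
  rw [Nat.card_eq_fintype_card] at hm
  obtain ⟨x, hx, hxtop⟩ := exists_rich_vector hk (fun α x => φ (α, x)) hm
  have hadj : ∀ α β : Fin (2 * k + 1), α < β → H.Adj (φ (α, x)) (φ (β, x)) := by
    intro α β h
    have hlt : (α : ℕ) < β := h
    rcases lt_or_ge (β : ℕ) (2 * k - 2) with hb | hb
    · obtain ⟨x', hφ, hdiv⟩ := hx β ⟨divergenceLevel α β, by
        unfold divergenceLevel
        split_ifs <;> omega⟩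
      rw [← hφ]
      exact φ.map_adj ((adj_low_of_lt hb h).2 hdiv)
    rcases lt_or_ge (α : ℕ) (2 * k - 2) with ha | ha
    · exact φ.map_adj ((adj_low_high ha hb).2 rfl)
    rcases high_cyclic ha hb h.ne with hc | hc
    · obtain ⟨y, hφ, hy⟩ := hxtop β hb
      rw [← hφ]
      exact φ.map_adj ((adj_high_succ hk hc).2 hy)
    · obtain ⟨y, hφ, hy⟩ := hxtop α ha
      rw [← hφ]
      exact φ.map_adj ((adj_high_succ hk hc).2 hy).symm
  have hadj' : ∀ α β : Fin (2 * k + 1), α ≠ β → H.Adj (φ (α, x)) (φ (β, x)) := fun α β h =>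
    (lt_or_gt_of_ne h).elim (hadj α β) fun h' => (hadj β α h').symm
  rw [SimpleGraph.not_cliqueFree_iff_top_isContained]
  exact ⟨⟨⟨fun α => φ (α, x), fun {α β} h => hadj' α β h⟩,
    fun α β e => by_contra fun h => (hadj' α β h).ne e⟩⟩

/-- Proposition 2.5: for `k ≥ 2`, `ε > 0`, `f ≥ 1` and `m` with
`(m−1)/((2k+1)m) ≥ 1/(2k+1) − ε` and `m > (2k+1)(k−1)f + 3f`, the graph `G2k1 k m`
has minimum degree at least `(m−1)·m^{k−2} = ((m−1)/((2k+1)m))·|V| ≥ (1/(2k+1) − ε)·|V|`,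
is triangle-free, has VC-dimension at most `4k²`, and every graph on at most `f`
vertices admitting a homomorphism from it contains a clique on `2k+1` vertices. -/
theorem odd_construction (k : ℕ) (hk : 2 ≤ k) (ε : ℝ) (hε : 0 < ε)
    (f m : ℕ) (hf : 1 ≤ f)
    (hm1 : (1 : ℝ) / (2 * (k : ℝ) + 1) - ε ≤
      ((m : ℝ) - 1) / ((2 * (k : ℝ) + 1) * (m : ℝ)))
    (hm2 : (2 * k + 1) * (k - 1) * f + 3 * f < m) :
    (∀ v, ((m - 1) * m ^ (k - 2) : ℕ) ≤ ((G2k1 k m).neighborSet v).ncard ∧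
      (((m - 1) * m ^ (k - 2) : ℕ) : ℝ) =
        (((m : ℝ) - 1) / ((2 * (k : ℝ) + 1) * (m : ℝ))) *
          (Nat.card (Fin (2 * k + 1) × (Fin (k - 1) → Fin m))) ∧
      ((1 : ℝ) / (2 * (k : ℝ) + 1) - ε) *
          (Nat.card (Fin (2 * k + 1) × (Fin (k - 1) → Fin m))) ≤
        ((G2k1 k m).neighborSet v).ncard) ∧
    (G2k1 k m).CliqueFree 3 ∧
    (∀ S : Set (Fin (2 * k + 1) × (Fin (k - 1) → Fin m)),
      Shattered (G2k1 k m) S → S.ncard ≤ 4 * k ^ 2) ∧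
    (∀ (W : Type) [Finite W], ∀ H : SimpleGraph W,
      Nat.card W ≤ f → Nonempty (G2k1 k m →g H) → ¬ H.CliqueFree (2 * k + 1)) := by
  have hmpos : 0 < m := by omega
  have hcard : (Nat.card (Fin (2 * k + 1) × (Fin (k - 1) → Fin m)) : ℝ) =
      (2 * k + 1) * (m * m ^ (k - 2)) := by
    rw [← pow_succ', show k - 2 + 1 = k - 1 by omega]
    simp
  have hdeg : (((m - 1) * m ^ (k - 2) : ℕ) : ℝ) =
      (((m : ℝ) - 1) / ((2 * (k : ℝ) + 1) * (m : ℝ))) *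
        (Nat.card (Fin (2 * k + 1) × (Fin (k - 1) → Fin m))) := by
    have : (m : ℝ) ≠ 0 := by positivity
    have : (2 * (k : ℝ) + 1) ≠ 0 := by positivity
    rw [hcard, Nat.cast_mul, Nat.cast_sub hmpos]
    field_simp
    push_cast
    ring
  refine ⟨fun v => ⟨le_ncard_neighborSet hk v, hdeg, ?_⟩, cliqueFree_three_G2k1 hk m,
    fun S hS => ncard_le_of_shattered_G2k1 hk S hS, ?_⟩
  · calc _ ≤ _ := mul_le_mul_of_nonneg_right hm1 (Nat.cast_nonneg _)
      _ = _ := hdeg.symm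
      _ ≤ _ := Nat.cast_le.2 (le_ncard_neighborSet hk v)
  · rintro W _ H hW ⟨φ⟩
    exact not_cliqueFree_of_hom_G2k1 hk (lt_of_le_of_lt (by gcongr) hm2) φ
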